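/- arXiv:1806.00403 — 5 statements merged into one kernel-verified Lean document; each statement's English description precedes it below -/
import Mathlib

section
/- Let k ≥ 2 be an integer, t ∈ [0,1) real, and z ∈ ℂ with |z| = 1. Define w_0 = z and w_{m+1} = B_{z,t,k}(w_m). Then for every m the iteration is well-defined (1 + t·w_m ≠ 0) and |w_m| = 1; moreover for every n, Z_n^+(z,t) ≠ 0 and Z_n^-(z,t)/Z_n^+(z,t) = w_n. In particular the partition function Z_n(z,t) = Z_n^+(z,t) + Z_n^-(z,t) vanishes if and only if the n-th iterate B_{z,t,k}^n(z) equals −1. -/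
open Finset

/-- The Blaschke product `B_{z,t,k}(w) = z·((w + t)/(1 + w·t))^k`. -/
noncomputable def Blaschke (z : ℂ) (t : ℝ) (k : ℕ) (w : ℂ) : ℂ :=
  z * ((w + (t : ℂ)) / (1 + w * (t : ℂ))) ^ k

/-- Vertices of the rooted `k`-ary tree of depth `n`: words of length `≤ n`
over the alphabet `Fin k`. -/
abbrev CayleyVtx (k n : ℕ) := Σ m : Fin (n+1), (Fin m.val → Fin k)

/-- The root vertex: the empty word. -/
def cayleyRoot (k n : ℕ) : CayleyVtx k n := ⟨⟨0, Nat.succ_pos n⟩, fun i => i.elim0⟩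

/-- Edges of the rooted `k`-ary tree of depth `n` are indexed by the non-root
vertices, i.e. by words of length `m+1` with `m < n`. -/
abbrev CayleyEdge (k n : ℕ) := Σ m : Fin n, (Fin (m.val + 1) → Fin k)

/-- The Gibbs weight of a spin configuration `σ` (with `true = +1`, `false = -1`):
`W(σ) = ∏_{edges {u,v}} t^{(1-σ(u)σ(v))/2} · ∏_{v} z^{(1-σ(v))/2}`. -/
noncomputable def cayleyWeight (k n : ℕ) (z t : ℂ) (σ : CayleyVtx k n → Bool) : ℂ :=
  (∏ v : CayleyVtx k n, if σ v then (1 : ℂ) else z) *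
  (∏ e : CayleyEdge k n,
    if σ ⟨⟨e.1.val, Nat.lt_succ_of_lt e.1.isLt⟩, fun i => e.2 i.castSucc⟩ =
       σ ⟨⟨e.1.val + 1, Nat.succ_lt_succ e.1.isLt⟩, e.2⟩ then (1 : ℂ) else t)

/-- Conditional partition function: sum of weights over all configurations with
prescribed spin `s` at the root (`true = +1`, `false = -1`). -/
noncomputable def Zcond (k n : ℕ) (z t : ℂ) (s : Bool) : ℂ :=
  ∑ σ : CayleyVtx k n → Bool, if σ (cayleyRoot k n) = s then cayleyWeight k n z t σ else 0

/-- The vertex of the tree of depth `n + 1` obtained by prefixing the letter `i` to a word. -/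
def cayleyChild {k n : ℕ} (i : Fin k) (v : CayleyVtx k n) : CayleyVtx k (n + 1) :=
  ⟨v.1.succ, Fin.cons (α := fun _ => Fin k) i v.2⟩

/-- Glue a root spin and configurations on the `k` subtrees into one configuration. -/
def cayleyGlue {k n : ℕ} (b : Bool) (τ : Fin k → CayleyVtx k n → Bool) :
    CayleyVtx k (n + 1) → Bool
  | ⟨⟨0, _⟩, _⟩ => b
  | ⟨⟨m + 1, h⟩, w⟩ => τ (w 0) ⟨⟨m, Nat.lt_of_succ_lt_succ h⟩, fun i => w i.succ⟩

theorem cayleyVtx_eq_root_or_child {k n : ℕ} (v : CayleyVtx k (n + 1)) :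
    v = cayleyRoot k (n + 1) ∨ ∃ i u, v = cayleyChild (n := n) i u := by
  obtain ⟨⟨m, h⟩, w⟩ := v
  cases m with
  | zero =>
    left
    have : w = fun i => i.elim0 := funext fun i => i.elim0
    subst this
    rfl
  | succ m =>
    right
    refine ⟨w 0, ⟨⟨m, Nat.lt_of_succ_lt_succ h⟩, fun i => w i.succ⟩, ?_⟩
    have : w = Fin.cons (α := fun _ => Fin k) (w 0) (fun i => w i.succ) :=
      (Fin.cons_self_tail w).symm
    exact congrArg (Sigma.mk (⟨m + 1, h⟩ : Fin (n + 1 + 1))) this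

theorem sum_cayley_config_succ {M : Type*} [AddCommMonoid M] (k n : ℕ)
    (F : Bool → (Fin k → CayleyVtx k n → Bool) → M) :
    ∑ σ : CayleyVtx k (n + 1) → Bool,
        F (σ (cayleyRoot k (n + 1))) (fun i v => σ (cayleyChild i v)) =
      ∑ b, ∑ τ, F b τ := by
  rw [← Fintype.sum_prod_type' F]
  refine Fintype.sum_bijective
    (fun σ : CayleyVtx k (n + 1) → Bool =>
      (σ (cayleyRoot k (n + 1)), fun (i : Fin k) (v : CayleyVtx k n) => σ (cayleyChild i v)))
    ⟨fun σ σ' h => ?_, fun p => ⟨cayleyGlue p.1 p.2, rfl⟩⟩ _ _ (fun _ => rfl)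
  rw [Prod.mk.injEq] at h
  funext v
  obtain rfl | ⟨i, u, rfl⟩ := cayleyVtx_eq_root_or_child v
  · exact h.1
  · exact congrFun (congrFun h.2 i) u

theorem prod_words_succ {M : Type*} [CommMonoid M] (k m : ℕ) (g : (Fin (m + 1) → Fin k) → M) :
    ∏ w, g w = ∏ i, ∏ w : Fin m → Fin k, g (Fin.cons (α := fun _ => Fin k) i w) := by
  rw [← (Fin.consEquiv fun _ : Fin (m + 1) => Fin k).prod_comp, Fintype.prod_prod_type]
  rfl

theorem prod_cayleyVtx_succ {M : Type*} [CommMonoid M] (k n : ℕ)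
    (g : CayleyVtx k (n + 1) → M) :
    ∏ v, g v = g (cayleyRoot k (n + 1)) * ∏ i, ∏ v : CayleyVtx k n, g (cayleyChild i v) := by
  rw [Fintype.prod_sigma, Fin.prod_univ_succ]
  congr 1
  · have : Unique (Fin (0 : Fin (n + 1 + 1)).val → Fin k) :=
      inferInstanceAs (Unique (Fin 0 → Fin k))
    rw [Fintype.prod_unique]
    congr 2
    funext i
    exact i.elim0
  · simp_rw [Fintype.prod_sigma]
    rw [Finset.prod_comm]
    exact Finset.prod_congr rfl fun m _ => prod_words_succ k m _

theorem prod_cayleyEdge_succ {M : Type*} [CommMonoid M] (k n : ℕ)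
    (g : CayleyVtx k (n + 1) → CayleyVtx k (n + 1) → M) :
    ∏ e : CayleyEdge k (n + 1),
        g ⟨⟨e.1.val, Nat.lt_succ_of_lt e.1.isLt⟩, fun i => e.2 i.castSucc⟩
          ⟨⟨e.1.val + 1, Nat.succ_lt_succ e.1.isLt⟩, e.2⟩ =
      ∏ i, (g (cayleyRoot k (n + 1)) (cayleyChild i (cayleyRoot k n)) *
        ∏ e : CayleyEdge k n,
          g (cayleyChild i ⟨⟨e.1.val, Nat.lt_succ_of_lt e.1.isLt⟩, fun i => e.2 i.castSucc⟩)
            (cayleyChild i ⟨⟨e.1.val + 1, Nat.succ_lt_succ e.1.isLt⟩, e.2⟩)) := by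
  rw [Finset.prod_mul_distrib, Fintype.prod_sigma, Fin.prod_univ_succ]
  congr 1
  · refine (prod_words_succ k 0 _).trans (Finset.prod_congr rfl fun i _ => ?_)
    rw [Fintype.prod_unique]
    congr 2
    funext i
    exact i.elim0
  · simp_rw [Fintype.prod_sigma]
    rw [Finset.prod_comm]
    refine Finset.prod_congr rfl fun m _ => (prod_words_succ k (m.val + 1) _).trans ?_
    refine Finset.prod_congr rfl fun i _ => Finset.prod_congr rfl fun w _ => ?_
    refine congrArg (fun u => g u _)
      (congrArg (Sigma.mk (⟨m.val + 1, _⟩ : Fin (n + 1 + 1))) (funext fun j => ?_))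
    exact Fin.cases rfl (fun _ => rfl) j

theorem cayleyWeight_succ (k n : ℕ) (z t : ℂ) (σ : CayleyVtx k (n + 1) → Bool) :
    cayleyWeight k (n + 1) z t σ =
      (if σ (cayleyRoot k (n + 1)) then 1 else z) *
        ∏ i, ((if σ (cayleyRoot k (n + 1)) = σ (cayleyChild i (cayleyRoot k n)) then 1 else t) *
          cayleyWeight k n z t (fun v => σ (cayleyChild i v))) := by
  unfold cayleyWeight
  rw [prod_cayleyVtx_succ, prod_cayleyEdge_succ k n (fun u v => if σ u = σ v then (1 : ℂ) else t)]
  simp only [Finset.prod_mul_distrib]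
  ring

theorem sum_ite_mul_cayleyWeight (k n : ℕ) (z t : ℂ) (s : Bool) :
    ∑ σ, (if s = σ (cayleyRoot k n) then 1 else t) * cayleyWeight k n z t σ =
      Zcond k n z t s + t * Zcond k n z t (!s) := by
  unfold Zcond
  rw [Finset.mul_sum, ← Finset.sum_add_distrib]
  refine Finset.sum_congr rfl fun σ _ => ?_
  cases s <;> cases σ (cayleyRoot k n) <;> simp

theorem Zcond_succ (k n : ℕ) (z t : ℂ) (s : Bool) :
    Zcond k (n + 1) z t s =
      (if s then 1 else z) * (Zcond k n z t s + t * Zcond k n z t (!s)) ^ k := by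
  rw [← sum_ite_mul_cayleyWeight, Zcond]
  simp_rw [cayleyWeight_succ]
  rw [sum_cayley_config_succ k n (fun b τ => if b = s then (if b then 1 else z) *
    ∏ i, ((if b = τ i (cayleyRoot k n) then 1 else t) * cayleyWeight k n z t (τ i)) else 0),
    Finset.sum_comm]
  simp only [Finset.sum_ite_eq', Finset.mem_univ, if_true]
  rw [← Finset.mul_sum, Fintype.sum_pow]

theorem Zcond_zero (k : ℕ) (z t : ℂ) (s : Bool) :
    Zcond k 0 z t s = if s then 1 else z := by
  have : Unique (CayleyVtx k 0) :=
    { default := cayleyRoot k 0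
      uniq := fun ⟨m, w⟩ => by
        obtain rfl := Fin.fin_one_eq_zero m
        exact congrArg (Sigma.mk (0 : Fin 1)) (funext fun i => i.elim0) }
  unfold Zcond cayleyWeight
  rw [← (Equiv.funUnique (CayleyVtx k 0) Bool).symm.sum_comp]
  cases s <;> simp

theorem one_add_ofReal_mul_ne_zero {t : ℝ} (ht0 : 0 ≤ t) (ht1 : t < 1) {w : ℂ} (hw : ‖w‖ = 1) :
    1 + (t : ℂ) * w ≠ 0 := by
  intro h
  have h' : (t : ℂ) * w = -1 := by linear_combination h
  have := congrArg norm h'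
  rw [norm_mul, hw, Complex.norm_of_nonneg ht0, norm_neg, norm_one] at this
  linarith

theorem norm_add_ofReal_eq {t : ℝ} {w : ℂ} (hw : ‖w‖ = 1) :
    ‖w + t‖ = ‖1 + w * t‖ := by
  have h : w.re * w.re + w.im * w.im = 1 := by
    rw [← Complex.normSq_apply, Complex.normSq_eq_norm_sq, hw, one_pow]
  rw [← sq_eq_sq₀ (norm_nonneg _) (norm_nonneg _), ← Complex.normSq_eq_norm_sq,
    ← Complex.normSq_eq_norm_sq, Complex.normSq_apply, Complex.normSq_apply]
  simp
  linear_combination (1 - t ^ 2) * h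

theorem norm_Blaschke {z : ℂ} (hz : ‖z‖ = 1) {t : ℝ} (ht0 : 0 ≤ t) (ht1 : t < 1) (k : ℕ)
    {w : ℂ} (hw : ‖w‖ = 1) : ‖Blaschke z t k w‖ = 1 := by
  have h : 1 + w * (t : ℂ) ≠ 0 := mul_comm (t : ℂ) w ▸ one_add_ofReal_mul_ne_zero ht0 ht1 hw
  rw [Blaschke, norm_mul, norm_pow, norm_div, norm_add_ofReal_eq hw,
    div_self (norm_ne_zero_iff.mpr h), hz, one_pow, one_mul]

theorem norm_iterate_Blaschke {z : ℂ} (hz : ‖z‖ = 1) {t : ℝ} (ht0 : 0 ≤ t) (ht1 : t < 1)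
    (k m : ℕ) : ‖(Blaschke z t k)^[m] z‖ = 1 := by
  induction m with
  | zero => exact hz
  | succ m ih =>
    rw [Function.iterate_succ_apply']
    exact norm_Blaschke hz ht0 ht1 k ih

theorem Zcond_true_ne_zero_and_false_eq {z : ℂ} (hz : ‖z‖ = 1) {t : ℝ} (ht0 : 0 ≤ t)
    (ht1 : t < 1) (k n : ℕ) :
    Zcond k n z t true ≠ 0 ∧
      Zcond k n z t false = (Blaschke z t k)^[n] z * Zcond k n z t true := by
  induction n with
  | zero => simp [Zcond_zero]
  | succ n ih =>
    obtain ⟨h0, h1⟩ := ih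
    have hw := one_add_ofReal_mul_ne_zero ht0 ht1 (norm_iterate_Blaschke hz ht0 ht1 k n)
    rw [Function.iterate_succ_apply', Zcond_succ, Zcond_succ]
    simp only [Bool.not_true, Bool.not_false, h1, if_true, Bool.false_eq_true, if_false, one_mul]
    generalize (Blaschke z t k)^[n] z = w at hw ⊢
    generalize Zcond k n z t true = Z at h0 ⊢
    have hZ : Z + t * (w * Z) = Z * (1 + t * w) := by ring
    rw [hZ]
    refine ⟨pow_ne_zero _ (mul_ne_zero h0 hw), ?_⟩
    rw [Blaschke, mul_assoc, ← mul_pow, mul_comm w (t : ℂ)]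
    congr 2
    rw [mul_left_comm, div_mul_cancel₀ _ hw]
    ring

theorem stmt1 (k : ℕ) (hk : 2 ≤ k) (t : ℝ) (ht0 : 0 ≤ t) (ht1 : t < 1)
    (z : ℂ) (hz : ‖z‖ = 1) :
    (∀ m : ℕ, 1 + (t : ℂ) * (Blaschke z t k)^[m] z ≠ 0 ∧
      ‖(Blaschke z t k)^[m] z‖ = 1) ∧
    (∀ n : ℕ, Zcond k n z (t : ℂ) true ≠ 0 ∧
      Zcond k n z (t : ℂ) false / Zcond k n z (t : ℂ) true = (Blaschke z t k)^[n] z) ∧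
    (∀ n : ℕ, Zcond k n z (t : ℂ) true + Zcond k n z (t : ℂ) false = 0 ↔
      (Blaschke z t k)^[n] z = -1) := by
  have key := fun n => Zcond_true_ne_zero_and_false_eq hz ht0 ht1 k n
  refine ⟨fun m => ?_, fun n => ⟨(key n).1, ?_⟩, fun n => ?_⟩
  · have hw := norm_iterate_Blaschke hz ht0 ht1 k m
    exact ⟨one_add_ofReal_mul_ne_zero ht0 ht1 hw, hw⟩
  · rw [(key n).2, mul_div_cancel_right₀ _ (key n).1]
  · rw [(key n).2, ← one_add_mul, mul_eq_zero, or_iff_left (key n).1, add_comm,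
      add_eq_zero_iff_eq_neg]
end

section
/- Let k ≥ 2 be an integer, t ∈ [0,1), and z ∈ ℂ with |z| = 1, and suppose (z,t) lies below the φ_e curve. Then B_{z,t,k} has a fixed point w_𝔻 with |w_𝔻| < 1; moreover w_𝔻 ≠ 0 whenever t > 0, and in that case 1/conj(w_𝔻) (which has modulus > 1) is also a fixed point of B_{z,t,k}. -/
/-- The root with nonnegative imaginary part of the quadratic
`t·w² + ((k+1)·t² − (k−1))·w + t = 0` (for `t_c ≤ t < 1` the discriminant
`(k+1)²t⁴ − 2(k²+1)t² + (k−1)²` is `≤ 0`, so the root is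
`(−b + i·√(−disc))/(2t)` with `b = (k+1)t² − (k−1)`). -/
noncomputable def wbullet (k : ℕ) (t : ℝ) : ℂ :=
  (-((((k : ℂ)) + 1) * (t : ℂ)^2 - ((k : ℂ) - 1)) +
    Complex.I * ((Real.sqrt (-(((k : ℝ) + 1)^2 * t^4 - 2 * ((k : ℝ)^2 + 1) * t^2 +
      ((k : ℝ) - 1)^2)) : ℝ) : ℂ)) / (2 * (t : ℂ))

/-- The edge angle `φ_e(t) = Arg(w_•(t)·((1 + w_•(t)·t)/(w_•(t) + t))^k)`. -/
noncomputable def phie (k : ℕ) (t : ℝ) : ℝ :=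
  (wbullet k t * ((1 + wbullet k t * (t : ℂ)) / (wbullet k t + (t : ℂ))) ^ k).arg

/-- `(z,t)` lies below the `φ_e` curve: either `0 ≤ t < t_c`, or
`t_c ≤ t < 1` and `φ_e(t) < |Arg z| ≤ π`. -/
def belowCurve (k : ℕ) (t : ℝ) (z : ℂ) : Prop :=
  (0 ≤ t ∧ t < ((k : ℝ) - 1) / ((k : ℝ) + 1)) ∨
  (((k : ℝ) - 1) / ((k : ℝ) + 1) ≤ t ∧ t < 1 ∧ phie k t < |z.arg| ∧ |z.arg| ≤ Real.pi)

open Polynomial ComplexConjugate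

/-- Lagrange's identity for a split polynomial with simple roots, in any degree. -/
theorem Polynomial.sum_roots_eval_div_eval_derivative {K : Type*} [Field K] [DecidableEq K]
    {P Q : K[X]} {n : ℕ} (hP : P.Splits) (hdeg : P.natDegree = n + 1)
    (hroots : ∀ x, P.IsRoot x → (derivative P).eval x ≠ 0) (hQ : Q.natDegree ≤ n) :
    ∑ x ∈ P.roots.toFinset, Q.eval x / (derivative P).eval x = Q.coeff n / P.leadingCoeff := by
  have hP0 : P ≠ 0 := by rintro rfl; simp at hdeg
  have hnodup : P.roots.Nodup := by
    rw [Multiset.nodup_iff_count_le_one]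
    intro x
    by_contra! h
    rw [count_roots, one_lt_rootMultiplicity_iff_isRoot hP0] at h
    exact hroots x h.1 h.2
  have hcard : P.roots.toFinset.card = n + 1 := by
    rw [Multiset.toFinset_card_of_nodup hnodup, ← hdeg, hP.natDegree_eq_card_roots]
  have hfac : P = C P.leadingCoeff * Lagrange.nodal P.roots.toFinset id := by
    conv_lhs => rw [hP.eq_prod_roots]
    rw [Lagrange.nodal_eq, Finset.prod_multiset_map_count]
    congr 1
    refine Finset.prod_congr rfl fun x hx => ?_
    rw [Multiset.count_eq_one_of_mem hnodup (Multiset.mem_toFinset.mp hx), pow_one, id]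
  have hQd : Q.degree < P.roots.toFinset.card := by
    rw [hcard]
    exact (degree_le_of_natDegree_le hQ).trans_lt (by exact_mod_cast Nat.lt_succ_self n)
  have key := Lagrange.coeff_eq_sum (s := P.roots.toFinset) (v := id)
    Function.injective_id.injOn hQd
  rw [hcard, Nat.add_sub_cancel] at key
  rw [key, Finset.sum_div]
  refine Finset.sum_congr rfl fun x hx => ?_
  have hd : (derivative P).eval x
      = P.leadingCoeff * ∏ j ∈ P.roots.toFinset.erase x, (id x - id j) := by
    conv_lhs => rw [hfac]
    have h := Lagrange.eval_nodal_derivative_eval_node_eq (v := id) hx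
    rw [Lagrange.eval_nodal] at h
    simp only [id] at h
    simp [h]
  rw [hd, id, mul_comm P.leadingCoeff, div_mul_eq_div_div]

theorem Complex.one_add_mul_ofReal_ne_zero {t : ℝ} (ht : |t| < 1) {w : ℂ} (hw : ‖w‖ = 1) :
    1 + w * t ≠ 0 := by
  intro h
  have h1 : w * t = -1 := by linear_combination h
  have h2 := congrArg norm h1
  rw [norm_mul, hw, Complex.norm_real, norm_neg, norm_one, one_mul, Real.norm_eq_abs] at h2
  linarith

theorem Complex.add_ofReal_eq_mul_conj {t : ℝ} {w : ℂ} (hw : ‖w‖ = 1) :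
    w + t = w * conj (1 + w * t) := by
  have h : w * conj w = 1 := by rw [Complex.mul_conj, Complex.normSq_eq_norm_sq, hw]; norm_num
  simp only [map_add, map_one, map_mul, Complex.conj_ofReal]
  linear_combination (-(t : ℂ)) * h

theorem Complex.normSq_one_add_mul_ofReal {t : ℝ} {w : ℂ} (hw : ‖w‖ = 1) :
    Complex.normSq (1 + w * t) = 1 + t ^ 2 + 2 * t * w.re := by
  have h : w.re * w.re + w.im * w.im = 1 := by
    rw [← Complex.normSq_apply, Complex.normSq_eq_norm_sq, hw]; norm_num
  simp only [Complex.normSq_apply, Complex.add_re, Complex.add_im, Complex.one_re, Complex.one_im,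
    Complex.mul_re, Complex.mul_im, Complex.ofReal_re, Complex.ofReal_im]
  linear_combination t ^ 2 * h

/-- `B_{z,t,k}` commutes with the reflection in the unit circle. -/
theorem Blaschke_one_div_conj {z : ℂ} (hz : ‖z‖ = 1) (t : ℝ) (k : ℕ) {w : ℂ} (hw : w ≠ 0) :
    Blaschke z t k (1 / conj w) = 1 / conj (Blaschke z t k w) := by
  have hw' : conj w ≠ 0 := by simpa using hw
  have hz0 : z ≠ 0 := by rintro rfl; simp at hz
  have hzz : (conj z)⁻¹ = z := by
    rw [← Complex.inv_eq_conj hz, inv_inv]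
  have h : (1 / conj w + t) / (1 + 1 / conj w * t) = ((conj w + t) / (1 + conj w * t))⁻¹ := by
    rw [inv_div, ← mul_div_mul_left _ _ hw']
    congr 1 <;> field_simp
  rw [Blaschke, h, Blaschke]
  simp only [map_mul, map_pow, map_div₀, map_add, map_one, Complex.conj_ofReal,
    one_div, mul_inv, inv_pow, hzz]

/-- The polynomial whose roots are the fixed points of `B_{z,t,k}`. -/
noncomputable def fixedPoly (z : ℂ) (t : ℝ) (k : ℕ) : ℂ[X] :=
  X * (C (t : ℂ) * X + C 1) ^ k - C z * (X + C (t : ℂ)) ^ k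

theorem eval_fixedPoly (z : ℂ) (t : ℝ) (k : ℕ) (w : ℂ) :
    (fixedPoly z t k).eval w = w * (1 + w * t) ^ k - z * (w + t) ^ k := by
  simp only [fixedPoly, eval_sub, eval_mul, eval_pow, eval_add, eval_X, eval_C]; ring

theorem natDegree_fixedPoly_head {t : ℝ} (ht : t ≠ 0) (k : ℕ) :
    (X * (C (t : ℂ) * X + C 1) ^ k).natDegree = k + 1 := by
  have ht' : (t : ℂ) ≠ 0 := by exact_mod_cast ht
  have h1 : (C (t : ℂ) * X + C 1) ^ k ≠ 0 :=
    pow_ne_zero _ (ne_zero_of_natDegree_gt (n := 0) (by rw [natDegree_linear ht']; simp))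
  rw [natDegree_X_mul h1, natDegree_pow, natDegree_linear ht', mul_one]

theorem natDegree_fixedPoly_tail (z : ℂ) (t : ℝ) (k : ℕ) :
    (C z * (X + C (t : ℂ)) ^ k).natDegree < k + 1 :=
  Nat.lt_succ_of_le ((natDegree_C_mul_le _ _).trans
    (by rw [natDegree_pow, natDegree_X_add_C, mul_one]))

theorem natDegree_fixedPoly (z : ℂ) {t : ℝ} (ht : t ≠ 0) (k : ℕ) :
    (fixedPoly z t k).natDegree = k + 1 := by
  rw [fixedPoly, natDegree_sub_eq_left_of_natDegree_lt, natDegree_fixedPoly_head ht]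
  rw [natDegree_fixedPoly_head ht]
  exact natDegree_fixedPoly_tail z t k

theorem leadingCoeff_fixedPoly (z : ℂ) {t : ℝ} (ht : t ≠ 0) (k : ℕ) :
    (fixedPoly z t k).leadingCoeff = (t : ℂ) ^ k := by
  have ht' : (t : ℂ) ≠ 0 := by exact_mod_cast ht
  rw [fixedPoly, leadingCoeff_sub_of_degree_lt, leadingCoeff_mul, leadingCoeff_pow,
    leadingCoeff_linear ht', leadingCoeff_X, one_mul]
  apply degree_lt_degree
  rw [natDegree_fixedPoly_head ht]
  exact natDegree_fixedPoly_tail z t k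

theorem Blaschke_eq_of_isRoot_fixedPoly {z : ℂ} (hz : z ≠ 0) {t : ℝ} (ht : |t| < 1) {k : ℕ}
    (hk : k ≠ 0) {w : ℂ} (h : (fixedPoly z t k).IsRoot w) : Blaschke z t k w = w := by
  rw [IsRoot, eval_fixedPoly] at h
  have h1 : 1 + w * t ≠ 0 := by
    intro h1
    have h2 : w + t = 0 := by
      rw [h1, zero_pow hk, mul_zero, zero_sub, neg_eq_zero, mul_eq_zero] at h
      exact (pow_eq_zero_iff hk).mp (h.resolve_left hz)
    have h3 : ((t ^ 2 : ℝ) : ℂ) = (1 : ℝ) := by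
      push_cast
      linear_combination (t : ℂ) * h2 - h1
    have h4 : t ^ 2 = 1 := by exact_mod_cast h3
    nlinarith [sq_abs t, abs_nonneg t]
  rw [Blaschke, div_pow]
  field_simp
  linear_combination -h

/-- At a fixed point `w` of `B_{z,t,k}` on the unit circle, the multiplier is the real number
`k(1 - t²)/|1 + wt|²`. -/
theorem eval_derivative_fixedPoly {z : ℂ} {t : ℝ} (ht : |t| < 1) {k : ℕ}
    (hk : k ≠ 0) {w : ℂ} (hw : ‖w‖ = 1) (h : (fixedPoly z t k).IsRoot w) :
    (derivative (fixedPoly z t k)).eval w =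
      (1 + w * t) ^ k * ((1 - k * (1 - t ^ 2) / Complex.normSq (1 + w * t) : ℝ) : ℂ) := by
  obtain ⟨n, rfl⟩ := Nat.exists_eq_add_one_of_ne_zero hk
  have h1 := Complex.one_add_mul_ofReal_ne_zero ht hw
  have hw0 : w ≠ 0 := by rintro rfl; simp at hw
  have h1' : conj (1 + w * t) ≠ 0 := by simpa only [ne_eq, map_eq_zero] using h1
  have hadd := Complex.add_ofReal_eq_mul_conj (t := t) hw
  have h2 : w + t ≠ 0 := by rw [hadd]; exact mul_ne_zero hw0 h1'
  rw [IsRoot, eval_fixedPoly] at h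
  have hd : (derivative (fixedPoly z t (n + 1))).eval w =
      (1 + w * t) ^ (n + 1) + w * ((n + 1) * (1 + w * t) ^ n * t)
        - z * ((n + 1) * (w + t) ^ n) := by
    simp [fixedPoly, derivative_pow]
    ring
  have hsq : ((Complex.normSq (1 + w * t) : ℝ) : ℂ) = (1 + w * t) * (w + t) / w := by
    rw [← Complex.mul_conj, hadd]; field_simp
  have hz : z * (w + t) ^ n = w * (1 + w * t) ^ (n + 1) / (w + t) := by
    rw [eq_div_iff h2]; linear_combination -h
  rw [hd]
  push_cast
  rw [hsq]
  have : z * (((n : ℂ) + 1) * (w + t) ^ n) = (n + 1) * (z * (w + t) ^ n) := by ring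
  rw [this, hz]
  field_simp
  ring

/-- If every fixed point of `B_{z,t,k}` on the unit circle is repelling, then `B_{z,t,k}` has a
fixed point inside the unit disc. -/
theorem exists_Blaschke_fixed_norm_lt_one {z : ℂ} (hz : ‖z‖ = 1) {t : ℝ} (ht0 : t ≠ 0)
    (ht : |t| < 1) {k : ℕ} (hk : k ≠ 0)
    (hrep : ∀ w, ‖w‖ = 1 → Blaschke z t k w = w → 1 + t ^ 2 + 2 * t * w.re < k * (1 - t ^ 2)) :
    ∃ w, ‖w‖ < 1 ∧ Blaschke z t k w = w := by
  by_contra! hno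
  have hz0 : z ≠ 0 := by rintro rfl; simp at hz
  have hfix : ∀ w, (fixedPoly z t k).IsRoot w → ‖w‖ = 1 ∧ Blaschke z t k w = w := by
    intro w hw
    have hB := Blaschke_eq_of_isRoot_fixedPoly hz0 ht hk hw
    refine ⟨le_antisymm ?_ (not_lt.mp fun h => hno w h hB), hB⟩
    by_contra! h
    have hw0 : w ≠ 0 := by rintro rfl; simp at h; linarith
    refine hno (1 / conj w) ?_ ?_
    · rw [norm_div, norm_one, RCLike.norm_conj]
      exact (div_lt_one (by linarith)).mpr h
    · rw [Blaschke_one_div_conj hz t k hw0, hB]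
  have hneg : ∀ w, ‖w‖ = 1 → Blaschke z t k w = w →
      1 - k * (1 - t ^ 2) / Complex.normSq (1 + w * t) < 0 := by
    intro w hw hB
    have hpos : 0 < Complex.normSq (1 + w * t) :=
      Complex.normSq_pos.mpr (Complex.one_add_mul_ofReal_ne_zero ht hw)
    rw [sub_neg, one_lt_div hpos, Complex.normSq_one_add_mul_ofReal hw]
    exact hrep w hw hB
  have hder := fun w hw => eval_derivative_fixedPoly ht hk (hfix w hw).1 hw
  have hone : ∀ w, (fixedPoly z t k).IsRoot w → (1 + w * t) ^ k ≠ 0 := fun w hw =>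
    pow_ne_zero k (Complex.one_add_mul_ofReal_ne_zero ht (hfix w hw).1)
  have hsum := sum_roots_eval_div_eval_derivative (P := fixedPoly z t k)
    (Q := (C (t : ℂ) * X + C 1) ^ k) (IsAlgClosed.splits _) (natDegree_fixedPoly z ht0 k)
    (fun w hw => by
      rw [hder w hw]
      exact mul_ne_zero (hone w hw)
        (by exact_mod_cast (hneg w (hfix w hw).1 (hfix w hw).2).ne))
    ((natDegree_pow_le).trans (by
      simpa using Nat.mul_le_mul_left k (natDegree_linear_le (a := (t : ℂ)) (b := 1))))
  have ht' : (t : ℂ) ≠ 0 := by exact_mod_cast ht0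
  have hcoeff : ((C (t : ℂ) * X + C 1) ^ k).coeff k = (t : ℂ) ^ k := by
    have := coeff_pow_of_natDegree_le (m := k) (natDegree_linear_le (a := (t : ℂ)) (b := 1))
    simpa [coeff_one] using this
  rw [hcoeff, leadingCoeff_fixedPoly z ht0, div_self (pow_ne_zero _ ht')] at hsum
  have hre : ∑ w ∈ (fixedPoly z t k).roots.toFinset,
      (1 - k * (1 - t ^ 2) / Complex.normSq (1 + w * t) : ℝ)⁻¹ = 1 := by
    apply Complex.ofReal_injective
    rw [Complex.ofReal_one, Complex.ofReal_sum]
    refine Eq.trans ?_ hsum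
    refine Finset.sum_congr rfl fun w hw => ?_
    have hw' : (fixedPoly z t k).IsRoot w := isRoot_of_mem_roots (Multiset.mem_toFinset.mp hw)
    have hev : ((C (t : ℂ) * X + C 1) ^ k).eval w = (1 + w * t) ^ k := by
      simp; ring
    rw [hder w hw', hev, ← div_div, div_self (hone w hw'), Complex.ofReal_inv, one_div]
  have hle : ∑ w ∈ (fixedPoly z t k).roots.toFinset,
      (1 - k * (1 - t ^ 2) / Complex.normSq (1 + w * t) : ℝ)⁻¹ ≤ 0 :=
    Finset.sum_nonpos fun w hw => by
      have hw' := hfix w (isRoot_of_mem_roots (Multiset.mem_toFinset.mp hw))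
      exact (inv_lt_zero.mpr (hneg w hw'.1 hw'.2)).le
  linarith

/-- A lift to the angle variable of `w ↦ w * ((1 + w * t) / (w + t)) ^ k` on the unit circle. -/
noncomputable def edgeLift (k : ℕ) (t θ : ℝ) : ℝ :=
  (1 - k) * θ + 2 * k * (Complex.log (1 + Complex.exp (θ * Complex.I) * t)).im

theorem Complex.one_add_mul_ofReal_mem_slitPlane {t : ℝ} (ht : |t| < 1) {w : ℂ} (hw : ‖w‖ = 1) :
    1 + w * t ∈ Complex.slitPlane := by
  apply Complex.mem_slitPlane_of_norm_lt_one
  rwa [norm_mul, hw, one_mul, Complex.norm_real, Real.norm_eq_abs]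

theorem exp_edgeLift {t : ℝ} (ht : |t| < 1) (k : ℕ) {w : ℂ} {θ : ℝ}
    (hθ : Complex.exp (θ * Complex.I) = w) :
    Complex.exp (edgeLift k t θ * Complex.I) = w * ((1 + w * t) / (w + t)) ^ k := by
  have hw : ‖w‖ = 1 := by rw [← hθ, Complex.norm_exp_ofReal_mul_I]
  have hw0 : w ≠ 0 := by rintro rfl; simp at hw
  have hu := Complex.one_add_mul_ofReal_ne_zero ht hw
  set L := Complex.log (1 + w * t) with hL
  have hexpL : Complex.exp L = 1 + w * t := Complex.exp_log hu
  have him : (2 * L.im : ℂ) * Complex.I = L - conj L := by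
    rw [Complex.sub_conj]; push_cast; ring
  have h : (edgeLift k t θ : ℂ) * Complex.I
      = θ * Complex.I + k * ((L - conj L) - θ * Complex.I) := by
    rw [← him, edgeLift, hθ, ← hL]; push_cast; ring
  rw [h, Complex.exp_add, Complex.exp_nat_mul, Complex.exp_sub, Complex.exp_sub,
    Complex.exp_conj, hexpL, hθ, Complex.add_ofReal_eq_mul_conj (t := t) hw, div_div,
    mul_comm w (conj _)]

theorem hasDerivAt_edgeLift {t : ℝ} (ht : |t| < 1) (k : ℕ) (θ : ℝ) :
    HasDerivAt (edgeLift k t) (1 - k * (1 - t ^ 2) / (1 + t ^ 2 + 2 * t * Real.cos θ)) θ := by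
  have hw := Complex.norm_exp_ofReal_mul_I θ
  have hns := Complex.normSq_one_add_mul_ofReal (t := t) hw
  have hpos := Complex.normSq_pos.mpr (Complex.one_add_mul_ofReal_ne_zero ht hw)
  have h1 : HasDerivAt (fun s : ℝ => Complex.exp (s * Complex.I))
      (Complex.exp (θ * Complex.I) * Complex.I) θ := by
    simpa using ((Complex.ofRealCLM.hasDerivAt (x := θ)).mul_const Complex.I).cexp
  have h2 := ((h1.mul_const (t : ℂ)).const_add 1).clog_real
    (Complex.one_add_mul_ofReal_mem_slitPlane ht hw)
  have h3 := (Complex.imCLM.hasFDerivAt (x := Complex.log _)).comp_hasDerivAt θ h2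
  have h4 := ((hasDerivAt_id θ).const_mul (1 - (k : ℝ))).add (h3.const_mul (2 * (k : ℝ)))
  refine h4.congr_deriv ?_
  rw [Complex.exp_ofReal_mul_I_re] at hns
  rw [← hns, Complex.imCLM_apply, Complex.div_im]
  field_simp
  rw [hns]
  simp [Complex.exp_ofReal_mul_I_re, Complex.exp_ofReal_mul_I_im]
  linear_combination 2 * k * t ^ 2 * Real.sin_sq_add_cos_sq θ

theorem edgeLift_zero {t : ℝ} (ht : |t| < 1) (k : ℕ) : edgeLift k t 0 = 0 := by
  have h : (1 : ℂ) + t = ((1 + t : ℝ) : ℂ) := by push_cast; rfl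
  have h0 : 0 ≤ 1 + t := by linarith [neg_abs_le t]
  rw [edgeLift, Complex.ofReal_zero, zero_mul, Complex.exp_zero, one_mul, h, Complex.log_im,
    Complex.arg_ofReal_of_nonneg h0, mul_zero, mul_zero, add_zero]

theorem one_add_sq_add_two_mul_cos_pos {t : ℝ} (ht : |t| < 1) (θ : ℝ) :
    0 < 1 + t ^ 2 + 2 * t * Real.cos θ := by
  have hw := Complex.norm_exp_ofReal_mul_I θ
  rw [← Complex.exp_ofReal_mul_I_re, ← Complex.normSq_one_add_mul_ofReal hw]
  exact Complex.normSq_pos.mpr (Complex.one_add_mul_ofReal_ne_zero ht hw)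

theorem edgeLift_le_self {t : ℝ} (ht : |t| < 1) (k : ℕ) {θ : ℝ} (hθ : 0 ≤ θ) :
    edgeLift k t θ ≤ θ := by
  have hd : ∀ s, HasDerivAt (fun s => edgeLift k t s - s) _ s := fun s =>
    (hasDerivAt_edgeLift ht k s).sub (hasDerivAt_id s)
  have h : Antitone fun s => edgeLift k t s - s :=
    antitone_of_deriv_nonpos (fun s => (hd s).differentiableAt) fun s => by
      rw [(hd s).deriv]
      have h1 := one_add_sq_add_two_mul_cos_pos ht s
      have h2 : 0 ≤ 1 - t ^ 2 := by nlinarith [sq_abs t, abs_nonneg t]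
      have : 0 ≤ k * (1 - t ^ 2) / (1 + t ^ 2 + 2 * t * Real.cos s) := by positivity
      linarith
  have := h hθ
  simp only [edgeLift_zero ht k] at this
  linarith

theorem monotoneOn_edgeLift {t : ℝ} (ht0 : 0 ≤ t) (ht : t < 1) (k : ℕ) {θ : ℝ} (hθ : θ ≤ Real.pi)
    (h : k * (1 - t ^ 2) ≤ 1 + t ^ 2 + 2 * t * Real.cos θ) :
    MonotoneOn (edgeLift k t) (Set.Icc 0 θ) := by
  have ht' : |t| < 1 := by rwa [abs_of_nonneg ht0]
  refine monotoneOn_of_deriv_nonneg (convex_Icc _ _)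
    (fun s _ => (hasDerivAt_edgeLift ht' k s).continuousAt.continuousWithinAt)
    (fun s _ => (hasDerivAt_edgeLift ht' k s).differentiableAt.differentiableWithinAt)
    fun s hs => ?_
  rw [interior_Icc] at hs
  rw [(hasDerivAt_edgeLift ht' k s).deriv, sub_nonneg,
    div_le_one (one_add_sq_add_two_mul_cos_pos ht' s)]
  have := Real.cos_le_cos_of_nonneg_of_le_pi hs.1.le hθ hs.2.le
  nlinarith

theorem wbullet_re (k : ℕ) (t : ℝ) :
    (wbullet k t).re = -((k + 1) * t ^ 2 - (k - 1)) / (2 * t) := by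
  have h : (2 * (t : ℂ)) = ((2 * t : ℝ) : ℂ) := by push_cast; rfl
  have h' : -(((k : ℂ) + 1) * (t : ℂ) ^ 2 - ((k : ℂ) - 1))
      = ((-(((k : ℝ) + 1) * t ^ 2 - (k - 1)) : ℝ) : ℂ) := by push_cast; rfl
  rw [wbullet, h, h', Complex.div_ofReal_re]
  simp only [Complex.add_re, Complex.ofReal_re, Complex.re_mul_ofReal, Complex.I_re, zero_mul,
    add_zero]

theorem wbullet_im (k : ℕ) (t : ℝ) :
    (wbullet k t).im = √(-(((k : ℝ) + 1) ^ 2 * t ^ 4 - 2 * ((k : ℝ) ^ 2 + 1) * t ^ 2 +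
      ((k : ℝ) - 1) ^ 2)) / (2 * t) := by
  have h : (2 * (t : ℂ)) = ((2 * t : ℝ) : ℂ) := by push_cast; rfl
  have h' : -(((k : ℂ) + 1) * (t : ℂ) ^ 2 - ((k : ℂ) - 1))
      = ((-(((k : ℝ) + 1) * t ^ 2 - (k - 1)) : ℝ) : ℂ) := by push_cast; rfl
  rw [wbullet, h, h', Complex.div_ofReal_im]
  simp only [Complex.add_im, Complex.ofReal_im, Complex.im_mul_ofReal, Complex.I_im, one_mul,
    zero_add]

theorem norm_wbullet {k : ℕ} (hk : 1 ≤ k) {t : ℝ} (ht0 : 0 < t) (ht1 : t < 1)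
    (ht : ((k : ℝ) - 1) / (k + 1) ≤ t) : ‖wbullet k t‖ = 1 := by
  have hk' : (1 : ℝ) ≤ k := by exact_mod_cast hk
  rw [div_le_iff₀ (by positivity)] at ht
  have h1 : 0 ≤ ((k + 1) * t - (k - 1)) * (t + 1) := mul_nonneg (by linarith) (by linarith)
  have h2 : 0 ≤ ((k + 1) * t + (k - 1)) * (1 - t) :=
    mul_nonneg (by nlinarith) (by linarith)
  have hdisc : 0 ≤ -(((k : ℝ) + 1) ^ 2 * t ^ 4 - 2 * ((k : ℝ) ^ 2 + 1) * t ^ 2 +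
      ((k : ℝ) - 1) ^ 2) := by nlinarith [mul_nonneg h1 h2]
  have h : Complex.normSq (wbullet k t) = 1 := by
    rw [Complex.normSq_apply, wbullet_re, wbullet_im, div_mul_div_comm, div_mul_div_comm,
      Real.mul_self_sqrt hdisc]
    field_simp
    ring
  rwa [Complex.normSq_eq_norm_sq, pow_eq_one_iff_of_nonneg (norm_nonneg _) two_ne_zero] at h

theorem exp_arg_mul_I_of_norm_eq_one {w : ℂ} (hw : ‖w‖ = 1) :
    Complex.exp (w.arg * Complex.I) = w := by
  simpa [hw] using Complex.norm_mul_exp_arg_mul_I w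

/-- Non-repelling fixed points in the closed upper half circle only occur on or above the `φ_e`
curve. -/
theorem abs_arg_le_phie_of_im_nonneg {k : ℕ} (hk : 1 ≤ k) {t : ℝ} (ht0 : 0 < t) (ht1 : t < 1)
    (ht : ((k : ℝ) - 1) / (k + 1) ≤ t) {w : ℂ} (hw : ‖w‖ = 1) (him : 0 ≤ w.im)
    (hrep : k * (1 - t ^ 2) ≤ 1 + t ^ 2 + 2 * t * w.re) :
    |(w * ((1 + w * t) / (w + t)) ^ k).arg| ≤ phie k t := by
  have ht' : |t| < 1 := by rwa [abs_of_pos ht0]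
  have hwb := norm_wbullet hk ht0 ht1 ht
  have hbim : 0 ≤ (wbullet k t).im := by rw [wbullet_im]; positivity
  have hbre : k * (1 - t ^ 2) = 1 + t ^ 2 + 2 * t * (wbullet k t).re := by
    rw [wbullet_re]; field_simp; ring
  have hcos : ∀ {v : ℂ}, ‖v‖ = 1 → Real.cos v.arg = v.re := fun {v} hv => by
    rw [Complex.cos_arg (by rintro rfl; simp at hv), hv, div_one]
  have h0 := Complex.arg_nonneg_iff.mpr him
  have hb0 := Complex.arg_nonneg_iff.mpr hbim
  have hbpi := Complex.arg_le_pi (wbullet k t)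
  have hle : w.arg ≤ (wbullet k t).arg := by
    rw [← Real.strictAntiOn_cos.le_iff_ge ⟨hb0, hbpi⟩ ⟨h0, Complex.arg_le_pi w⟩, hcos hw, hcos hwb]
    nlinarith
  have hmono := monotoneOn_edgeLift ht0.le ht1 k hbpi (by rw [hcos hwb]; exact hbre.le)
  have hnonneg := hmono ⟨le_rfl, hb0⟩ ⟨h0, hle⟩ h0
  have hgle := hmono ⟨h0, hle⟩ ⟨hb0, le_rfl⟩ hle
  have hbself := edgeLift_le_self ht' k hb0
  rw [edgeLift_zero ht'] at hnonneg
  have harg : ∀ {x : ℝ}, 0 ≤ x → x ≤ Real.pi → (Complex.exp (x * Complex.I)).arg = x :=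
    fun {x} hx hx' => by
      rw [Complex.arg_exp_mul_I, toIocMod_eq_self]
      constructor <;> linarith [Real.pi_pos]
  rw [phie, ← exp_edgeLift ht' k (exp_arg_mul_I_of_norm_eq_one hw),
    ← exp_edgeLift ht' k (exp_arg_mul_I_of_norm_eq_one hwb), harg hnonneg (by linarith),
    harg (by linarith) (by linarith), abs_of_nonneg hnonneg]
  exact hgle

theorem abs_arg_le_phie {k : ℕ} (hk : 1 ≤ k) {t : ℝ} (ht0 : 0 < t) (ht1 : t < 1)
    (ht : ((k : ℝ) - 1) / (k + 1) ≤ t) {w : ℂ} (hw : ‖w‖ = 1)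
    (hrep : k * (1 - t ^ 2) ≤ 1 + t ^ 2 + 2 * t * w.re) :
    |(w * ((1 + w * t) / (w + t)) ^ k).arg| ≤ phie k t := by
  rcases le_total 0 w.im with him | him
  · exact abs_arg_le_phie_of_im_nonneg hk ht0 ht1 ht hw him hrep
  · have h := abs_arg_le_phie_of_im_nonneg hk ht0 ht1 ht (w := conj w)
      (by rw [RCLike.norm_conj, hw]) (by simpa using him) (by simpa using hrep)
    have hc : conj w * ((1 + conj w * t) / (conj w + t)) ^ k
        = conj (w * ((1 + w * t) / (w + t)) ^ k) := by simp
    have habs : ∀ v : ℂ, |(conj v).arg| = |v.arg| := fun v => by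
      rw [Complex.arg_conj]; split_ifs with hv <;> simp [hv]
    rwa [hc, habs] at h

theorem repelling_of_belowCurve {k : ℕ} (hk : 2 ≤ k) {t : ℝ} (ht0 : 0 < t) (ht1 : t < 1)
    {z : ℂ} (hbc : belowCurve k t z) {w : ℂ} (hw : ‖w‖ = 1) (hfix : Blaschke z t k w = w) :
    1 + t ^ 2 + 2 * t * w.re < k * (1 - t ^ 2) := by
  have hre : w.re ≤ 1 := (Complex.re_le_norm w).trans hw.le
  rcases hbc with ⟨-, h⟩ | ⟨h, -, h', -⟩
  · rw [lt_div_iff₀ (by positivity)] at h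
    nlinarith [mul_pos (show 0 < (k - 1) - t * (k + 1) by linarith) (show 0 < 1 + t by linarith),
      mul_nonneg ht0.le (sub_nonneg.mpr hre)]
  · by_contra! hrep
    have hle := abs_arg_le_phie (by omega) ht0 ht1 h hw hrep
    have ht' : |t| < 1 := by rwa [abs_of_pos ht0]
    have hw0 : w ≠ 0 := by rintro rfl; simp at hw
    have hu := Complex.one_add_mul_ofReal_ne_zero ht' hw
    have hadd : w + t ≠ 0 := by
      rw [Complex.add_ofReal_eq_mul_conj hw]
      exact mul_ne_zero hw0 (by simpa only [ne_eq, map_eq_zero] using hu)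
    have hz : w * ((1 + w * t) / (w + t)) ^ k = z := by
      have hcancel : (w + t) / (1 + w * t) * ((1 + w * t) / (w + t)) = 1 := by field_simp
      nth_rewrite 1 [← hfix]
      rw [Blaschke, mul_assoc, ← mul_pow, hcancel, one_pow, mul_one]
    rw [hz] at hle
    linarith

theorem stmt2 (k : ℕ) (hk : 2 ≤ k) (t : ℝ) (ht0 : 0 ≤ t) (ht1 : t < 1)
    (z : ℂ) (hz : ‖z‖ = 1) (hbc : belowCurve k t z) :
    ∃ wD : ℂ, ‖wD‖ < 1 ∧ Blaschke z t k wD = wD ∧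
      (0 < t → wD ≠ 0 ∧ 1 < ‖1 / (starRingEnd ℂ) wD‖ ∧
        Blaschke z t k (1 / (starRingEnd ℂ) wD) = 1 / (starRingEnd ℂ) wD) := by
  rcases ht0.eq_or_lt with rfl | ht0
  · exact ⟨0, by simp, by simp [Blaschke, show k ≠ 0 by omega], fun h => absurd h (lt_irrefl 0)⟩
  have ht' : |t| < 1 := by rwa [abs_of_pos ht0]
  have hz0 : z ≠ 0 := by rintro rfl; simp at hz
  obtain ⟨w, hw, hfix⟩ := exists_Blaschke_fixed_norm_lt_one hz ht0.ne' ht' (by omega)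
    fun w hw hfix => repelling_of_belowCurve hk ht0 ht1 hbc hw hfix
  have hw0 : w ≠ 0 := by
    rintro rfl
    simp [Blaschke, hz0, ht0.ne'] at hfix
  refine ⟨w, hw, hfix, fun _ => ⟨hw0, ?_, ?_⟩⟩
  · rw [norm_div, norm_one, RCLike.norm_conj]
    exact (one_lt_div (norm_pos_iff.mpr hw0)).mpr hw
  · rw [Blaschke_one_div_conj hz t k hw0, hfix]
end

section
/- Let B be a finite Blaschke product of degree k ≥ 2. If u ∈ ℂ with |u| < 1 satisfies B(u) = u, then |B'(u)| < 1, u is the unique fixed point of B in the open unit disk, and for every w with |w| < 1 the iterates B^n(w) converge to u as n → ∞. -/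
open Metric Set Filter Topology

/-- The disk automorphism that sends `a` to `0`. -/
noncomputable def diskMobius (a z : ℂ) : ℂ := (z - a) / (1 - (starRingEnd ℂ) a * z)

theorem one_sub_conj_mul_ne_zero {a z : ℂ} (ha : ‖a‖ < 1) (hz : ‖z‖ < 1) :
    1 - (starRingEnd ℂ) a * z ≠ 0 := by
  intro h
  have h1 : ‖(starRingEnd ℂ) a * z‖ = 1 := by rw [← sub_eq_zero.mp h, norm_one]
  rw [norm_mul, RCLike.norm_conj] at h1
  nlinarith [norm_nonneg a, norm_nonneg z]

theorem norm_diskMobius_lt_one {a z : ℂ} (ha : ‖a‖ < 1) (hz : ‖z‖ < 1) :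
    ‖diskMobius a z‖ < 1 := by
  rw [diskMobius, norm_div, div_lt_one (norm_pos_iff.mpr (one_sub_conj_mul_ne_zero ha hz))]
  refine lt_of_pow_lt_pow_left₀ 2 (norm_nonneg _) ?_
  have ha' : 0 < 1 - ‖a‖ ^ 2 := by nlinarith [norm_nonneg a]
  have hz' : 0 < 1 - ‖z‖ ^ 2 := by nlinarith [norm_nonneg z]
  have key : ‖1 - (starRingEnd ℂ) a * z‖ ^ 2 - ‖z - a‖ ^ 2
      = (1 - ‖a‖ ^ 2) * (1 - ‖z‖ ^ 2) := by
    simp only [Complex.sq_norm, Complex.normSq_apply, Complex.sub_re, Complex.sub_im,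
      Complex.mul_re, Complex.mul_im, Complex.conj_re, Complex.conj_im, Complex.one_re,
      Complex.one_im]
    ring
  nlinarith [mul_pos ha' hz']

theorem diskMobius_self (a : ℂ) : diskMobius a a = 0 := by simp [diskMobius]

theorem diskMobius_neg_zero (a : ℂ) : diskMobius (-a) 0 = a := by simp [diskMobius]

theorem diskMobius_neg_diskMobius {a z : ℂ} (ha : ‖a‖ < 1) (hz : ‖z‖ < 1) :
    diskMobius (-a) (diskMobius a z) = z := by
  have h1 := one_sub_conj_mul_ne_zero ha hz
  have h2 := one_sub_conj_mul_ne_zero ha ha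
  have hnum : (z - a) / (1 - (starRingEnd ℂ) a * z) + a
      = z * (1 - (starRingEnd ℂ) a * a) / (1 - (starRingEnd ℂ) a * z) := by
    rw [div_add' _ _ _ h1]; ring
  have hden : 1 + (starRingEnd ℂ) a * ((z - a) / (1 - (starRingEnd ℂ) a * z))
      = (1 - (starRingEnd ℂ) a * a) / (1 - (starRingEnd ℂ) a * z) := by
    rw [mul_div_assoc', add_div' _ _ _ h1]; ring
  rw [diskMobius, diskMobius, map_neg, sub_neg_eq_add, neg_mul, sub_neg_eq_add, hnum, hden,
    div_div_div_cancel_right₀ h1, mul_div_assoc, div_self h2, mul_one]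

theorem diskMobius_diskMobius_neg {a z : ℂ} (ha : ‖a‖ < 1) (hz : ‖z‖ < 1) :
    diskMobius a (diskMobius (-a) z) = z := by
  simpa using diskMobius_neg_diskMobius (a := -a) (by simpa using ha) hz

theorem differentiableAt_diskMobius {a z : ℂ} (ha : ‖a‖ < 1) (hz : ‖z‖ < 1) :
    DifferentiableAt ℂ (diskMobius a) z := by
  have h := one_sub_conj_mul_ne_zero ha hz
  unfold diskMobius
  fun_prop (disch := exact h)

/-- A holomorphic self-map of the unit disk that fixes `0` and is not injective is a strict
contraction towards `0` on compact subsets. -/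
theorem norm_dslope_lt_one_of_not_injOn {g : ℂ → ℂ} (hd : DifferentiableOn ℂ g (ball 0 1))
    (hm : MapsTo g (ball 0 1) (ball 0 1)) (h0 : g 0 = 0) (hinj : ¬ InjOn g (ball 0 1))
    {z : ℂ} (hz : z ∈ ball (0 : ℂ) 1) : ‖dslope g 0 z‖ < 1 := by
  have hm' : MapsTo g (ball 0 1) (closedBall (g 0) 1) := by
    rw [h0]; exact hm.mono_right ball_subset_closedBall
  have hle := Complex.norm_dslope_le_div_of_mapsTo_ball hd hm' hz
  rw [div_one] at hle
  refine hle.lt_of_ne fun heq => hinj ?_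
  have haff := Complex.affine_of_mapsTo_ball_of_norm_dslope_eq_div hd hm' hz (by simpa using heq)
  have hne : dslope g 0 z ≠ 0 := norm_ne_zero_iff.mp (by rw [heq]; exact one_ne_zero)
  intro x hx y hy hxy
  rw [haff hx, haff hy] at hxy
  simpa [hne] using hxy

theorem norm_eq_norm_mul_norm_dslope {g : ℂ → ℂ} (h0 : g 0 = 0) (z : ℂ) :
    ‖g z‖ = ‖z‖ * ‖dslope g 0 z‖ := by
  rw [← norm_mul, ← smul_eq_mul]
  simpa [h0] using congrArg norm (sub_smul_dslope g 0 z).symm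

theorem tendsto_iterate_zero_of_not_injOn {g : ℂ → ℂ} (hd : DifferentiableOn ℂ g (ball 0 1))
    (hm : MapsTo g (ball 0 1) (ball 0 1)) (h0 : g 0 = 0) (hinj : ¬ InjOn g (ball 0 1))
    {w : ℂ} (hw : ‖w‖ < 1) : Tendsto (fun n : ℕ => g^[n] w) atTop (𝓝 0) := by
  have hsub : closedBall (0 : ℂ) ‖w‖ ⊆ ball 0 1 := closedBall_subset_ball hw
  have hcont : ContinuousOn (dslope g 0) (closedBall 0 ‖w‖) :=
    ((Complex.differentiableOn_dslope (ball_mem_nhds 0 one_pos)).mpr hd).continuousOn.mono hsub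
  obtain ⟨z₀, hz₀, hmax⟩ := (isCompact_closedBall (0 : ℂ) ‖w‖).exists_isMaxOn
    ⟨0, by simp⟩ hcont.norm
  set q := ‖dslope g 0 z₀‖
  have hq : q < 1 := norm_dslope_lt_one_of_not_injOn hd hm h0 hinj (hsub hz₀)
  have hq0 : 0 ≤ q := norm_nonneg _
  have hbound : ∀ n : ℕ, ‖g^[n] w‖ ≤ q ^ n * ‖w‖ := by
    intro n
    induction n with
    | zero => simp
    | succ n ih =>
      have hmem : g^[n] w ∈ closedBall (0 : ℂ) ‖w‖ := mem_closedBall_zero_iff.mpr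
        (ih.trans (mul_le_of_le_one_left (norm_nonneg w) (pow_le_one₀ hq0 hq.le)))
      rw [Function.iterate_succ_apply', norm_eq_norm_mul_norm_dslope h0]
      calc ‖g^[n] w‖ * ‖dslope g 0 (g^[n] w)‖ ≤ q ^ n * ‖w‖ * q := by
            gcongr
            exact hmax hmem
        _ = q ^ (n + 1) * ‖w‖ := by ring
  refine squeeze_zero_norm hbound ?_
  simpa using (tendsto_pow_atTop_nhds_zero_of_lt_one hq0 hq).mul_const ‖w‖

/-- A holomorphic self-map of the unit disk that is not injective and has a fixed point `u`:
`u` is attracting, it is the only fixed point, and all orbits converge to it. -/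
theorem attracting_fixedPoint_of_not_injOn {f : ℂ → ℂ} (hd : DifferentiableOn ℂ f (ball 0 1))
    (hm : MapsTo f (ball 0 1) (ball 0 1)) (hinj : ¬ InjOn f (ball 0 1))
    {u : ℂ} (hu : ‖u‖ < 1) (hfix : f u = u) :
    ‖deriv f u‖ < 1 ∧ (∀ v : ℂ, ‖v‖ < 1 → f v = v → v = u) ∧
      ∀ w : ℂ, ‖w‖ < 1 → Tendsto (fun n : ℕ => f^[n] w) atTop (𝓝 u) := by
  have hu' : ‖-u‖ < 1 := by simpa using hu
  have hmf : ∀ {z : ℂ}, ‖z‖ < 1 → ‖f z‖ < 1 := fun hz => by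
    simpa using hm (mem_ball_zero_iff.mpr hz)
  have hdf : ∀ {z : ℂ}, ‖z‖ < 1 → DifferentiableAt ℂ f z := fun hz =>
    hd.differentiableAt (isOpen_ball.mem_nhds (mem_ball_zero_iff.mpr hz))
  set g : ℂ → ℂ := fun z => diskMobius u (f (diskMobius (-u) z)) with hg
  have hconj : ∀ {z : ℂ}, ‖z‖ < 1 → g (diskMobius u z) = diskMobius u (f z) := fun hz => by
    simp only [hg, diskMobius_neg_diskMobius hu hz]
  have hgm : MapsTo g (ball 0 1) (ball 0 1) := fun z hz => by
    rw [mem_ball_zero_iff] at hz ⊢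
    exact norm_diskMobius_lt_one hu (hmf (norm_diskMobius_lt_one hu' hz))
  have hgd : DifferentiableOn ℂ g (ball 0 1) := fun z hz => by
    rw [mem_ball_zero_iff] at hz
    have hz' := norm_diskMobius_lt_one hu' hz
    exact ((differentiableAt_diskMobius hu (hmf hz')).comp z
      ((hdf hz').comp z (differentiableAt_diskMobius hu' hz))).differentiableWithinAt
  have hg0 : g 0 = 0 := by simp only [hg, diskMobius_neg_zero, hfix, diskMobius_self]
  have hginj : ¬ InjOn g (ball 0 1) := fun h => hinj fun x hx y hy hxy => by
    rw [mem_ball_zero_iff] at hx hy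
    have := h (mem_ball_zero_iff.mpr (norm_diskMobius_lt_one hu hx))
      (mem_ball_zero_iff.mpr (norm_diskMobius_lt_one hu hy))
      (by rw [hconj hx, hconj hy, hxy])
    rw [← diskMobius_neg_diskMobius hu hx, this, diskMobius_neg_diskMobius hu hy]
  have hlim : ∀ w : ℂ, ‖w‖ < 1 → Tendsto (fun n : ℕ => f^[n] w) atTop (𝓝 u) := by
    intro w hw
    have hiter : ∀ n : ℕ, ‖f^[n] w‖ < 1 ∧ g^[n] (diskMobius u w) = diskMobius u (f^[n] w) := by
      intro n
      induction n with
      | zero => exact ⟨hw, rfl⟩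
      | succ n ih =>
        rw [Function.iterate_succ_apply', Function.iterate_succ_apply', ih.2, hconj ih.1]
        exact ⟨hmf ih.1, rfl⟩
    have hcont : Tendsto (diskMobius (-u)) (𝓝 0) (𝓝 u) := by
      have := (differentiableAt_diskMobius hu' (z := 0) (by simp)).continuousAt.tendsto
      rwa [diskMobius_neg_zero] at this
    refine (hcont.comp (tendsto_iterate_zero_of_not_injOn hgd hgm hg0 hginj
      (norm_diskMobius_lt_one hu hw))).congr fun n => ?_
    rw [Function.comp_apply, (hiter n).2, diskMobius_neg_diskMobius hu (hiter n).1]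
  refine ⟨?_, fun v hv hfv => ?_, hlim⟩
  · have hderiv : deriv g 0 = deriv f u := by
      have hu0 : diskMobius (-u) 0 = u := diskMobius_neg_zero u
      have h1 : HasDerivAt (diskMobius (-u)) (deriv (diskMobius (-u)) 0) 0 :=
        (differentiableAt_diskMobius hu' (by simp)).hasDerivAt
      have h2 : HasDerivAt f (deriv f u) (diskMobius (-u) 0) := by
        rw [hu0]; exact (hdf hu).hasDerivAt
      have h3 : HasDerivAt (diskMobius u) (deriv (diskMobius u) u) u :=
        (differentiableAt_diskMobius hu hu).hasDerivAt
      have hid : deriv (diskMobius u) u * deriv (diskMobius (-u)) 0 = 1 := by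
        have hcomp := HasDerivAt.comp_of_eq (0 : ℂ) h3 h1 hu0.symm
        refine hcomp.unique ((hasDerivAt_id (0 : ℂ)).congr_of_eventuallyEq ?_)
        filter_upwards [ball_mem_nhds (0 : ℂ) one_pos] with z hz
        exact diskMobius_diskMobius_neg hu (mem_ball_zero_iff.mp hz)
      have h23 := HasDerivAt.comp (0 : ℂ) h2 h1
      have h3' : HasDerivAt (diskMobius u) (deriv (diskMobius u) u)
          ((f ∘ diskMobius (-u)) 0) := by
        rw [Function.comp_apply, hu0, hfix]; exact h3
      have hall : HasDerivAt g _ 0 := HasDerivAt.comp (0 : ℂ) h3' h23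
      rw [hall.deriv]
      linear_combination deriv f u * hid
    have := norm_dslope_lt_one_of_not_injOn hgd hgm hg0 hginj (mem_ball_self one_pos)
    rwa [dslope_same, hderiv] at this
  · refine tendsto_nhds_unique (tendsto_const_nhds.congr fun n => ?_) (hlim v hv)
    exact (Function.iterate_fixed hfv n).symm

theorem norm_prod_diskMobius_lt_one {k : ℕ} (hk : k ≠ 0) {a : Fin k → ℂ}
    (ha : ∀ i, ‖a i‖ < 1) {w : ℂ} (hw : ‖w‖ < 1) : ‖∏ i, diskMobius (a i) w‖ < 1 := by
  obtain ⟨m, rfl⟩ := Nat.exists_eq_succ_of_ne_zero hk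
  rw [norm_prod, Fin.prod_univ_succ]
  exact mul_lt_one_of_nonneg_of_lt_one_left (norm_nonneg _)
    (norm_diskMobius_lt_one (ha 0) hw)
    (Finset.prod_le_one (fun _ _ => norm_nonneg _)
      fun i _ => (norm_diskMobius_lt_one (ha i.succ) hw).le)

theorem not_injOn_prod_diskMobius {k : ℕ} (hk : 2 ≤ k) {a : Fin k → ℂ}
    (ha : ∀ i, ‖a i‖ < 1) : ¬ InjOn (fun w => ∏ i, diskMobius (a i) w) (ball 0 1) := by
  intro hinj
  have hzero : ∀ i, ∏ j, diskMobius (a j) (a i) = 0 := fun i =>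
    Finset.prod_eq_zero (Finset.mem_univ i) (diskMobius_self _)
  let i₀ : Fin k := ⟨0, by omega⟩
  have heq : ∀ i, a i = a i₀ := fun i =>
    hinj (mem_ball_zero_iff.mpr (ha i)) (mem_ball_zero_iff.mpr (ha i₀))
      ((hzero i).trans (hzero i₀).symm)
  have ha' : ‖-a i₀‖ < 1 := by simpa using ha i₀
  have hζ := Complex.isPrimitiveRoot_exp k (by omega)
  set ζ := Complex.exp (2 * Real.pi * Complex.I / k)
  have hζn : ‖ζ‖ = 1 := hζ.norm'_eq_one (by omega)
  have h1 : ‖(1 / 2 : ℂ)‖ < 1 := by norm_num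
  have h2 : ‖ζ * (1 / 2 : ℂ)‖ < 1 := by rw [norm_mul, hζn, one_mul]; exact h1
  have hpts : diskMobius (-a i₀) (ζ * (1 / 2)) = diskMobius (-a i₀) (1 / 2) := by
    refine hinj (mem_ball_zero_iff.mpr (norm_diskMobius_lt_one ha' h2))
      (mem_ball_zero_iff.mpr (norm_diskMobius_lt_one ha' h1)) ?_
    simp only [heq, diskMobius_diskMobius_neg (ha i₀) h1, diskMobius_diskMobius_neg (ha i₀) h2,
      Finset.prod_const, Finset.card_univ, Fintype.card_fin, mul_pow, hζ.pow_eq_one, one_mul]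
  have h3 := congrArg (diskMobius (a i₀)) hpts
  rw [diskMobius_diskMobius_neg (ha i₀) h1, diskMobius_diskMobius_neg (ha i₀) h2] at h3
  exact hζ.ne_one (by omega) (by linear_combination 2 * h3)

theorem stmt4 (k : ℕ) (hk : 2 ≤ k) (φ : ℝ) (a : Fin k → ℂ)
    (ha : ∀ i, ‖a i‖ < 1) (B : ℂ → ℂ)
    (hB : ∀ w : ℂ, B w = Complex.exp ((φ : ℂ) * Complex.I) *
      ∏ i : Fin k, (w - a i) / (1 - (starRingEnd ℂ) (a i) * w))
    (u : ℂ) (hu : ‖u‖ < 1) (hfix : B u = u) :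
    ‖deriv B u‖ < 1 ∧
    (∀ v : ℂ, ‖v‖ < 1 → B v = v → v = u) ∧
    (∀ w : ℂ, ‖w‖ < 1 →
      Filter.Tendsto (fun n : ℕ => B^[n] w) Filter.atTop (nhds u)) := by
  have hB' : ∀ w, B w = Complex.exp (φ * Complex.I) * ∏ i, diskMobius (a i) w := hB
  have hd : DifferentiableOn ℂ B (ball 0 1) := fun w hw => by
    rw [mem_ball_zero_iff] at hw
    rw [funext hB']
    exact ((DifferentiableAt.fun_finsetProd fun i _ =>
      differentiableAt_diskMobius (ha i) hw).const_mul _).differentiableWithinAt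
  have hm : MapsTo B (ball 0 1) (ball 0 1) := fun w hw => by
    rw [mem_ball_zero_iff] at hw ⊢
    rw [hB', norm_mul, Complex.norm_exp_ofReal_mul_I, one_mul]
    exact norm_prod_diskMobius_lt_one (by omega) ha hw
  refine attracting_fixedPoint_of_not_injOn hd hm (fun hinj => ?_) hu hfix
  refine not_injOn_prod_diskMobius hk ha fun x hx y hy hxy => hinj hx hy ?_
  rw [hB', hB']
  exact congrArg _ hxy
end

section
/- Let k ≥ 2 be an integer, t ∈ (0,1), and z ∈ ℂ with |z| = 1, and set P(w) = z·(w + t)^k − w·(1 + w·t)^k. If w_• ∈ ℂ satisfies P(w_•) = 0 and P'(w_•) = 0, then w_• ≠ −t, w_• satisfies the quadratic t·w_•² + ((k+1)·t² − (k−1))·w_• + t = 0 (equivalently, k·w_•·(1 − t²) = (w_• + t)·(1 + w_•·t)), and z = w_•·((1 + w_•·t)/(w_• + t))^k. -/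
theorem stmt5 (k : ℕ) (hk : 2 ≤ k) (t : ℝ) (ht0 : 0 < t) (ht1 : t < 1)
    (z : ℂ) (hz : ‖z‖ = 1) (w : ℂ)
    (hP : z * (w + (t : ℂ)) ^ k - w * (1 + w * (t : ℂ)) ^ k = 0)
    (hP' : deriv (fun u : ℂ => z * (u + (t : ℂ)) ^ k - u * (1 + u * (t : ℂ)) ^ k) w = 0) :
    w ≠ -(t : ℂ) ∧
    (t : ℂ) * w ^ 2 + (((k : ℂ) + 1) * (t : ℂ) ^ 2 - ((k : ℂ) - 1)) * w + (t : ℂ) = 0 ∧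
    (k : ℂ) * w * (1 - (t : ℂ) ^ 2) = (w + (t : ℂ)) * (1 + w * (t : ℂ)) ∧
    z = w * ((1 + w * (t : ℂ)) / (w + (t : ℂ))) ^ k := by
  have ht : (t : ℂ) ≠ 0 := Complex.ofReal_ne_zero.mpr ht0.ne'
  have hz0 : z ≠ 0 := by
    rintro rfl
    simp at hz
  have ht2 : 1 - (t : ℂ) ^ 2 ≠ 0 := by
    have h : (1 - t ^ 2 : ℝ) ≠ 0 := by nlinarith
    exact_mod_cast h
  have hw : w ≠ -(t : ℂ) := by
    rintro rfl
    have hb : 1 + -(t : ℂ) * t ≠ 0 := by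
      convert ht2 using 1
      ring
    rw [neg_add_cancel, zero_pow (by omega), mul_zero, zero_sub, neg_eq_zero] at hP
    exact mul_ne_zero (neg_ne_zero.mpr ht) (pow_ne_zero _ hb) hP
  have ha : w + (t : ℂ) ≠ 0 := fun h => hw (eq_neg_of_add_eq_zero_left h)
  have hb : 1 + w * (t : ℂ) ≠ 0 := by
    intro h
    rw [h, zero_pow (by omega), mul_zero, sub_zero] at hP
    exact mul_ne_zero hz0 (pow_ne_zero _ ha) hP
  have hd : HasDerivAt (fun u : ℂ => z * (u + (t : ℂ)) ^ k - u * (1 + u * (t : ℂ)) ^ k)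
      (z * (k * (w + t) ^ (k - 1) * 1) -
        (1 * (1 + w * t) ^ k + w * (k * (1 + w * t) ^ (k - 1) * (1 * t)))) w :=
    ((((hasDerivAt_id w).add_const (t : ℂ)).pow k).const_mul z).sub
      ((hasDerivAt_id w).mul ((((hasDerivAt_id w).mul_const (t : ℂ)).const_add 1).pow k))
  rw [hd.deriv] at hP'
  have hkey : (k : ℂ) * w * (1 - (t : ℂ) ^ 2) = (w + (t : ℂ)) * (1 + w * (t : ℂ)) := by
    obtain ⟨m, rfl⟩ : ∃ m, k = m + 1 := ⟨k - 1, by omega⟩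
    rw [Nat.add_sub_cancel] at hP'
    apply mul_right_cancel₀ (pow_ne_zero m hb)
    rw [pow_succ, pow_succ] at hP
    rw [pow_succ] at hP'
    linear_combination (w + t) * hP' - ((m + 1 : ℕ) : ℂ) * hP
  refine ⟨hw, by linear_combination -hkey, hkey, ?_⟩
  rw [div_pow]
  field_simp
  linear_combination hP
end

section
/- Let k ≥ 2 be an integer, t ∈ (0,1), and z ∈ ℂ with |z| = 1, and suppose w_𝔻 with |w_𝔻| < 1 is a fixed point of B = B_{z,t,k}. Let ψ(w) = (w − w_𝔻)/(1 − conj(w_𝔻)·w) and set B̌ = ψ ∘ B ∘ ψ^{−1}. Then (1/2π)·∫_0^{2π} log|B̌'(e^{iθ})| dθ = log(k·(1 − t²)) − 2·log|1 + w_𝔻·t|. -/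
/-- The disk automorphism sending `0` to `a`. -/
noncomputable def diskAut (a w : ℂ) : ℂ :=
  (w + a) / (1 + (starRingEnd ℂ) a * w)

lemma one_add_mul_ne_zero_of_norm {u v : ℂ} (hu : ‖u‖ < 1) (hv : ‖v‖ ≤ 1) : 1 + u * v ≠ 0 := by
  intro h
  have h1 : ‖u * v‖ = 1 := by
    rw [show u * v = -1 by linear_combination h]
    simp
  rw [norm_mul] at h1
  nlinarith [norm_nonneg u, norm_nonneg v]

lemma one_add_conj_mul_ne_zero {a w : ℂ} (ha : ‖a‖ < 1) (hw : ‖w‖ ≤ 1) :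
    1 + (starRingEnd ℂ) a * w ≠ 0 :=
  one_add_mul_ne_zero_of_norm (by simpa using ha) hw

lemma norm_sq_one_add_conj_mul_sub (a w : ℂ) :
    ‖1 + (starRingEnd ℂ) a * w‖ ^ 2 - ‖w + a‖ ^ 2 = (1 - ‖a‖ ^ 2) * (1 - ‖w‖ ^ 2) := by
  simp only [Complex.sq_norm, Complex.normSq_apply, Complex.add_re, Complex.add_im,
    Complex.mul_re, Complex.mul_im, Complex.conj_re, Complex.conj_im, Complex.one_re,
    Complex.one_im]
  ring

lemma norm_diskAut_le_one {a w : ℂ} (ha : ‖a‖ < 1) (hw : ‖w‖ ≤ 1) : ‖diskAut a w‖ ≤ 1 := by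
  have hpos : 0 < ‖1 + (starRingEnd ℂ) a * w‖ := norm_pos_iff.2 (one_add_conj_mul_ne_zero ha hw)
  rw [diskAut, norm_div, div_le_one hpos]
  refine le_of_sq_le_sq ?_ hpos.le
  have h1 : 0 ≤ 1 - ‖a‖ ^ 2 := by nlinarith [norm_nonneg a]
  have h2 : 0 ≤ 1 - ‖w‖ ^ 2 := by nlinarith [norm_nonneg w]
  nlinarith [norm_sq_one_add_conj_mul_sub a w, mul_nonneg h1 h2]

lemma norm_diskAut_eq_one {a w : ℂ} (ha : ‖a‖ < 1) (hw : ‖w‖ = 1) : ‖diskAut a w‖ = 1 := by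
  have hpos : 0 < ‖1 + (starRingEnd ℂ) a * w‖ :=
    norm_pos_iff.2 (one_add_conj_mul_ne_zero ha hw.le)
  rw [diskAut, norm_div, div_eq_one_iff_eq hpos.ne']
  refine (sq_eq_sq₀ (norm_nonneg _) hpos.le).1 ?_
  have h := norm_sq_one_add_conj_mul_sub a w
  rw [hw] at h
  linarith

lemma hasDerivAt_diskAut {a w : ℂ} (h : 1 + (starRingEnd ℂ) a * w ≠ 0) :
    HasDerivAt (diskAut a) ((1 - (starRingEnd ℂ) a * a) / (1 + (starRingEnd ℂ) a * w) ^ 2) w := by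
  have h1 : HasDerivAt (fun w : ℂ => w + a) 1 w := (hasDerivAt_id w).add_const a
  have h2 : HasDerivAt (fun w : ℂ => 1 + (starRingEnd ℂ) a * w) ((starRingEnd ℂ) a) w := by
    simpa using ((hasDerivAt_id w).const_mul ((starRingEnd ℂ) a)).const_add 1
  refine HasDerivAt.congr_deriv (f := diskAut a) (h1.div h2 h) ?_
  congr 1
  ring

lemma analyticAt_diskAut {a w : ℂ} (h : 1 + (starRingEnd ℂ) a * w ≠ 0) :
    AnalyticAt ℂ (diskAut a) w := by
  unfold diskAut
  fun_prop (disch := exact h)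

lemma Blaschke_eq_mul_diskAut_pow (z : ℂ) (t : ℝ) (k : ℕ) (w : ℂ) :
    Blaschke z t k w = z * diskAut t w ^ k := by
  simp [Blaschke, diskAut, mul_comm]

lemma norm_Blaschke_le_one {z : ℂ} (hz : ‖z‖ = 1) {t : ℝ} (ht : ‖(t : ℂ)‖ < 1) (k : ℕ) {w : ℂ}
    (hw : ‖w‖ ≤ 1) : ‖Blaschke z t k w‖ ≤ 1 := by
  rw [Blaschke_eq_mul_diskAut_pow, norm_mul, hz, one_mul, norm_pow]
  exact pow_le_one₀ (norm_nonneg _) (norm_diskAut_le_one ht hw)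

lemma hasDerivAt_Blaschke (z : ℂ) {t : ℝ} (k : ℕ) {w : ℂ} (h : 1 + (t : ℂ) * w ≠ 0) :
    HasDerivAt (Blaschke z t k)
      (z * (k * diskAut t w ^ (k - 1) * ((1 - (t : ℂ) ^ 2) / (1 + (t : ℂ) * w) ^ 2))) w := by
  have hd := ((hasDerivAt_diskAut (a := (t : ℂ)) (w := w) (by simpa using h)).pow k).const_mul z
  rw [Complex.conj_ofReal, ← sq] at hd
  refine hd.congr_of_eventuallyEq (.of_forall fun w => ?_)
  simp [Blaschke_eq_mul_diskAut_pow]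

/-- The conjugate of the Blaschke product by the disk automorphism sending `a` to `0`. -/
noncomputable def conjBlaschke (z : ℂ) (t : ℝ) (k : ℕ) (a w : ℂ) : ℂ :=
  diskAut (-a) (Blaschke z t k (diskAut a w))

/-- A function without zeros on the closed unit disk whose modulus on the unit circle is that
of the derivative of `conjBlaschke`: the derivative with its Blaschke factor removed. -/
noncomputable def outerDeriv (z : ℂ) (t : ℝ) (k : ℕ) (a w : ℂ) : ℂ :=
  (1 - (starRingEnd ℂ) a * a) / (1 + (starRingEnd ℂ) (-a) * Blaschke z t k (diskAut a w)) ^ 2 *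
    (k * ((1 - (t : ℂ) ^ 2) / (1 + (t : ℂ) * diskAut a w) ^ 2) *
      ((1 - (starRingEnd ℂ) a * a) / (1 + (starRingEnd ℂ) a * w) ^ 2))

lemma one_sub_conj_mul_self_ne_zero {a : ℂ} (ha : ‖a‖ < 1) : 1 - (starRingEnd ℂ) a * a ≠ 0 := by
  simpa [sub_eq_add_neg] using
    one_add_conj_mul_ne_zero (a := a) (w := -a) ha (by simpa using ha.le)

section

variable {z a w : ℂ} {t : ℝ}

lemma norm_deriv_conjBlaschke (hz : ‖z‖ = 1) (ht : ‖(t : ℂ)‖ < 1) (k : ℕ) (ha : ‖a‖ < 1)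
    (hw : ‖w‖ = 1) :
    ‖deriv (conjBlaschke z t k a) w‖ = ‖outerDeriv z t k a w‖ := by
  have hφ : ‖diskAut a w‖ = 1 := norm_diskAut_eq_one ha hw
  have h1 := hasDerivAt_diskAut (one_add_conj_mul_ne_zero ha hw.le)
  have h2 := hasDerivAt_Blaschke z k (one_add_mul_ne_zero_of_norm ht hφ.le)
  have h3 := hasDerivAt_diskAut (one_add_conj_mul_ne_zero (a := -a) (by simpa using ha)
    (norm_Blaschke_le_one hz ht k hφ.le))
  have h : HasDerivAt (conjBlaschke z t k a) _ w := h3.comp w (h2.comp w h1)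
  rw [h.deriv, outerDeriv]
  simp only [norm_mul, norm_pow, hz, norm_diskAut_eq_one ht hφ, map_neg, neg_mul_neg, one_pow,
    one_mul, mul_one]

lemma analyticAt_outerDeriv (hz : ‖z‖ = 1) (ht : ‖(t : ℂ)‖ < 1) (k : ℕ) (ha : ‖a‖ < 1)
    (hw : ‖w‖ ≤ 1) : AnalyticAt ℂ (outerDeriv z t k a) w := by
  have hφ := norm_diskAut_le_one ha hw
  have h1 := one_add_conj_mul_ne_zero ha hw
  have h2 := one_add_mul_ne_zero_of_norm ht hφ
  have h3 := one_add_conj_mul_ne_zero (a := -a) (by simpa using ha)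
    (norm_Blaschke_le_one hz ht k hφ)
  have a1 := analyticAt_diskAut h1
  have a2 : AnalyticAt ℂ (fun w => Blaschke z t k (diskAut a w)) w := by
    simp only [Blaschke_eq_mul_diskAut_pow]
    exact analyticAt_const.mul
      (((analyticAt_diskAut (by simpa using h2)).comp a1).pow k)
  unfold outerDeriv
  exact (analyticAt_const.div ((analyticAt_const.add (analyticAt_const.mul a2)).pow 2)
    (pow_ne_zero 2 h3)).mul ((analyticAt_const.mul (analyticAt_const.div
      ((analyticAt_const.add (analyticAt_const.mul a1)).pow 2) (pow_ne_zero 2 h2))).mul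
    (analyticAt_const.div ((analyticAt_const.add (analyticAt_const.mul analyticAt_id)).pow 2)
      (pow_ne_zero 2 h1)))

lemma outerDeriv_ne_zero (hz : ‖z‖ = 1) (ht : ‖(t : ℂ)‖ < 1) {k : ℕ} (hk : k ≠ 0) (ha : ‖a‖ < 1)
    (hw : ‖w‖ ≤ 1) : outerDeriv z t k a w ≠ 0 := by
  have hφ := norm_diskAut_le_one ha hw
  have h1 := one_add_conj_mul_ne_zero ha hw
  have h2 := one_add_mul_ne_zero_of_norm ht hφ
  have h3 := one_add_conj_mul_ne_zero (a := -a) (by simpa using ha)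
    (norm_Blaschke_le_one hz ht k hφ)
  have h4 := one_sub_conj_mul_self_ne_zero ha
  have h5 : 1 - (t : ℂ) ^ 2 ≠ 0 := by
    simpa [sq] using one_sub_conj_mul_self_ne_zero ht
  have h6 : (k : ℂ) ≠ 0 := Nat.cast_ne_zero.2 hk
  unfold outerDeriv
  positivity

lemma outerDeriv_zero {k : ℕ} (ha : ‖a‖ < 1) (hfix : Blaschke z t k a = a) :
    outerDeriv z t k a 0 = k * (1 - (t : ℂ) ^ 2) / (1 + a * t) ^ 2 := by
  have h := one_sub_conj_mul_self_ne_zero ha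
  have h0 : diskAut a 0 = a := by simp [diskAut]
  simp only [outerDeriv, h0, hfix, map_neg, neg_mul, mul_zero, add_zero, ← sub_eq_add_neg,
    mul_comm (t : ℂ) a]
  field_simp

end

theorem stmt14 (k : ℕ) (hk : 2 ≤ k) (t : ℝ) (ht0 : 0 < t) (ht1 : t < 1)
    (z : ℂ) (hz : ‖z‖ = 1)
    (wD : ℂ) (hwD : ‖wD‖ < 1) (hfix : Blaschke z t k wD = wD) :
    (1 / (2 * Real.pi)) * ∫ θ in (0 : ℝ)..(2 * Real.pi),
        Real.log (‖deriv
          (fun w : ℂ =>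
            (Blaschke z t k ((w + wD) / (1 + (starRingEnd ℂ) wD * w)) - wD) /
            (1 - (starRingEnd ℂ) wD *
              Blaschke z t k ((w + wD) / (1 + (starRingEnd ℂ) wD * w))))
          (Complex.exp ((θ : ℂ) * Complex.I))‖)
      = Real.log ((k : ℝ) * (1 - t ^ 2)) - 2 * Real.log (‖1 + wD * (t : ℂ)‖) := by
  have ht : ‖(t : ℂ)‖ < 1 := by
    rw [Complex.norm_real, Real.norm_eq_abs, abs_of_pos ht0]
    exact ht1
  have hmean : Real.circleAverage (fun w => Real.log ‖outerDeriv z t k wD w‖) 0 1 =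
      Real.log ‖outerDeriv z t k wD 0‖ := by
    refine InnerProductSpace.HarmonicOnNhd.circleAverage_eq fun w hw => ?_
    have hw' : ‖w‖ ≤ 1 := by simpa using hw
    exact (analyticAt_outerDeriv hz ht k hwD hw').harmonicAt_log_norm
      (outerDeriv_ne_zero hz ht (by omega) hwD hw')
  have hconj : (fun w : ℂ =>
      (Blaschke z t k ((w + wD) / (1 + (starRingEnd ℂ) wD * w)) - wD) /
        (1 - (starRingEnd ℂ) wD *
          Blaschke z t k ((w + wD) / (1 + (starRingEnd ℂ) wD * w)))) =
      conjBlaschke z t k wD := by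
    funext w
    simp [conjBlaschke, diskAut, sub_eq_add_neg]
  have hint : ∀ θ : ℝ, Real.log ‖deriv (conjBlaschke z t k wD) (Complex.exp (θ * Complex.I))‖ =
      Real.log ‖outerDeriv z t k wD (circleMap 0 1 θ)‖ := fun θ => by
    rw [norm_deriv_conjBlaschke hz ht k hwD (Complex.norm_exp_ofReal_mul_I θ)]
    simp [circleMap]
  rw [hconj]
  simp only [hint]
  rw [one_div, ← smul_eq_mul, ← Real.circleAverage_def
    (f := fun w => Real.log ‖outerDeriv z t k wD w‖), hmean, outerDeriv_zero hwD hfix]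
  have hpos : 0 < (k : ℝ) * (1 - t ^ 2) :=
    mul_pos (by exact_mod_cast (by omega : 0 < k)) (by nlinarith)
  have hne : 1 + wD * (t : ℂ) ≠ 0 := one_add_mul_ne_zero_of_norm hwD ht.le
  have hnum : ‖(k : ℂ) * (1 - (t : ℂ) ^ 2)‖ = k * (1 - t ^ 2) := by
    rw [show (k : ℂ) * (1 - (t : ℂ) ^ 2) = ((k * (1 - t ^ 2) : ℝ) : ℂ) by push_cast; rfl,
      Complex.norm_real, Real.norm_eq_abs, abs_of_pos hpos]
  rw [norm_div, norm_pow, hnum, Real.log_div hpos.ne' (pow_ne_zero 2 (norm_ne_zero_iff.2 hne)),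
    Real.log_pow]
  norm_num
end
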